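/- Let π and σ be the permutations of {1,…,9} determined by the bottom-line words (9,8,7,6,5,4,3,2,1) and (4,3,7,6,5,9,8,2,1) respectively. Both are irreducible and their extended Rauzy classes are distinct: σ ∉ R_ex(π). (These two extended Rauzy classes correspond to the hyperelliptic and nonhyperelliptic connected components of the stratum H(3,3).) -/

import Mathlib

/-- The auxiliary permutation `q m` of `Fin n` (`0`-indexed version of the
renumbering used in the Rauzy operations): it fixes every `j ≤ m`, sends
`j ↦ j + 1` for `m < j < n - 1`, and sends the last index `n - 1` to `m + 1`.
(When `m = n - 1` it is the identity.) -/
def rauzyQ {n : ℕ} (m : Fin n) : Equiv.Perm (Fin n) :=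
  (Fin.revPerm * Fin.cycleRange ⟨n - 2 - m.val, by have := m.isLt; omega⟩ * Fin.revPerm)⁻¹

/-- Rauzy operation `a`: in the two-line representation of `π` (top line
`(0, …, n-1)`, bottom line `(π⁻¹ 0, …, π⁻¹ (n-1))`) one deletes the last entry
of the bottom line and reinserts it immediately to the right of the entry
`n - 1` of the bottom line.  In terms of permutations this is
`a(π) = q (π (n-1)) ∘ π`. -/
def rauzyA {n : ℕ} (π : Equiv.Perm (Fin n)) : Equiv.Perm (Fin n) :=
  if h : n = 0 then π else rauzyQ (π ⟨n - 1, by omega⟩) * π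

/-- Rauzy operation `b`: one deletes the last entry `n - 1` of the top line,
reinserts it immediately to the right of the entry `π⁻¹ (n-1)` of the top line
and relabels the symbols in the order of their appearance in the new top line.
In terms of permutations the relabelling map is `r = q (π⁻¹ (n-1))` and
`b(π) = π ∘ r⁻¹`. -/
def rauzyB {n : ℕ} (π : Equiv.Perm (Fin n)) : Equiv.Perm (Fin n) :=
  if h : n = 0 then π else π * (rauzyQ (π⁻¹ ⟨n - 1, by omega⟩))⁻¹

/-- Operation `c`: reverse the order of the entries in each line, interchange
the two lines and relabel so that the top line is again `(0, …, n-1)`.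
In terms of permutations, `c(π) = w ∘ π⁻¹ ∘ w` where `w : j ↦ n - 1 - j`. -/
def rauzyC {n : ℕ} (π : Equiv.Perm (Fin n)) : Equiv.Perm (Fin n) :=
  Fin.revPerm * π⁻¹ * Fin.revPerm

/-- A permutation of `{0, …, n-1}` is irreducible if it maps no proper initial
segment `{0, …, k}` (with `k < n - 1`) to itself. -/
def IrreduciblePerm {n : ℕ} (π : Equiv.Perm (Fin n)) : Prop :=
  ∀ k : ℕ, k + 1 < n → ¬ (∀ i : Fin n, i.val ≤ k → (π i).val ≤ k)

/-- The Rauzy class of `π`: the smallest set of permutations containing `π`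
and closed under the Rauzy operations `a` and `b`. -/
def RauzyClass {n : ℕ} (π : Equiv.Perm (Fin n)) : Set (Equiv.Perm (Fin n)) :=
  {σ | ∀ S : Set (Equiv.Perm (Fin n)), π ∈ S →
    (∀ τ ∈ S, rauzyA τ ∈ S) → (∀ τ ∈ S, rauzyB τ ∈ S) → σ ∈ S}

/-- The extended Rauzy class of `π`: the smallest set of permutations
containing `π` and closed under the operations `a`, `b` and `c`. -/
def RauzyClassEx {n : ℕ} (π : Equiv.Perm (Fin n)) : Set (Equiv.Perm (Fin n)) :=
  {σ | ∀ S : Set (Equiv.Perm (Fin n)), π ∈ S →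
    (∀ τ ∈ S, rauzyA τ ∈ S) → (∀ τ ∈ S, rauzyB τ ∈ S) →
    (∀ τ ∈ S, rauzyC τ ∈ S) → σ ∈ S}

/-- The one-line word `(π 0, …, π (n - 1))` of a permutation. -/
def permWord {n : ℕ} (π : Equiv.Perm (Fin n)) : List ℕ :=
  List.ofFn fun i => (π i : ℕ)

/-- The effect of `rauzyA` on words of length `9`. -/
def wordA (w : List ℕ) : List ℕ :=
  let m := w.getD 8 0
  w.map fun x => bif x.ble m then x else bif x.beq 8 then m + 1 else x + 1

/-- The effect of inversion on words of length `9`. -/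
def wordInv (w : List ℕ) : List ℕ :=
  (List.range 9).map fun i => w.findIdx fun x => x.beq i

/-- The effect of conjugation by the order reversal on words of length `9`. -/
def wordRev (w : List ℕ) : List ℕ :=
  (w.map fun x => 8 - x).reverse

/-- The natural number whose base `16` digits, least significant first, are the entries of a
word. -/
def encodeWord : List ℕ → ℕ
  | [] => 0
  | x :: w => x + 16 * encodeWord w

/-- The first `k` base `16` digits of a natural number. -/
def decodeWord : ℕ → ℕ → List ℕ
  | 0, _ => []
  | k + 1, c => c % 16 :: decodeWord k (c / 16)

/-- Boolean membership in a list of natural numbers. -/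
def codeMem (c : ℕ) : List ℕ → Bool
  | [] => false
  | d :: L => bif c.beq d then true else codeMem c L

/-- Depth-first search, with bounded fuel, for the codes of words reachable by `wordA`, `wordInv`
and `wordRev` from the codes in the second argument. Matching on the head of that list makes the
kernel evaluate it to a numeral. -/
def exploreCodes : ℕ → List ℕ → List ℕ → List ℕ
  | 0, _, seen => seen
  | _ + 1, [], seen => seen
  | k + 1, 0 :: todo, seen => exploreCodes k todo seen
  | k + 1, (c + 1) :: todo, seen =>
    bif codeMem (c + 1) seen then exploreCodes k todo seen
    else
      exploreCodes k
        (encodeWord (wordA (decodeWord 9 (c + 1))) :: encodeWord (wordInv (decodeWord 9 (c + 1))) ::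
          encodeWord (wordRev (decodeWord 9 (c + 1))) :: todo)
        ((c + 1) :: seen)

/-- The codes of the words of the hyperelliptic Rauzy class on nine letters. -/
def hyperellipticCodes : List ℕ :=
  exploreCodes 1000 [encodeWord [8, 7, 6, 5, 4, 3, 2, 1, 0]] []

theorem codeMem_eq_true_iff (c : ℕ) (L : List ℕ) : codeMem c L = true ↔ c ∈ L := by
  induction L with
  | nil => simp [codeMem]
  | cons d L ih =>
    cases h : c.beq d
    · simp [codeMem, h, ih, Nat.ne_of_beq_eq_false h]
    · simp [codeMem, Nat.eq_of_beq_eq_true h]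

theorem decodeWord_encodeWord (w : List ℕ) (hw : ∀ x ∈ w, x < 16) :
    decodeWord w.length (encodeWord w) = w := by
  induction w with
  | nil => rfl
  | cons x w ih =>
    have hx : x < 16 := hw x (by simp)
    have h₁ : (x + 16 * encodeWord w) % 16 = x := by omega
    have h₂ : (x + 16 * encodeWord w) / 16 = encodeWord w := by omega
    simp [decodeWord, encodeWord, h₁, h₂, ih fun y hy => hw y (by simp [hy])]

theorem decodeWord_encodeWord_permWord (π : Equiv.Perm (Fin 9)) :
    decodeWord 9 (encodeWord (permWord π)) = permWord π := by
  have h := decodeWord_encodeWord (permWord π) fun x hx => by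
    obtain ⟨i, rfl⟩ := List.mem_ofFn.1 hx
    omega
  simpa only [permWord, List.length_ofFn] using h

theorem rauzyQ_val (m x : Fin 9) :
    (rauzyQ m x : ℕ) =
      bif (x : ℕ).ble m then (x : ℕ) else bif (x : ℕ).beq 8 then (m : ℕ) + 1 else x + 1 := by
  revert m x
  decide +kernel

theorem permWord_rauzyA (π : Equiv.Perm (Fin 9)) :
    permWord (rauzyA π) = wordA (permWord π) := by
  simp [permWord, wordA, rauzyA, rauzyQ_val, List.ofFn_succ]

theorem permWord_inv (π : Equiv.Perm (Fin 9)) :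
    permWord π⁻¹ = wordInv (permWord π) := by
  refine List.ext_getElem (by simp [permWord, wordInv]) fun i h₁ h₂ => ?_
  have hi : i < 9 := by simpa [permWord] using h₁
  simp only [permWord, wordInv, List.getElem_ofFn, List.getElem_map, List.getElem_range]
  symm
  rw [List.findIdx_eq (by simp)]
  refine ⟨by rw [List.getElem_ofFn]; simp, fun j hj => ?_⟩
  have hj9 : j < 9 := hj.trans (Fin.is_lt _)
  rw [List.getElem_ofFn]
  by_contra hne
  have hji : π ⟨j, hj9⟩ = ⟨i, hi⟩ := Fin.ext (by simpa using hne)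
  rw [← hji] at hj
  simp at hj

theorem permWord_revPerm_conj (π : Equiv.Perm (Fin 9)) :
    permWord (Fin.revPerm * π * Fin.revPerm) = wordRev (permWord π) := by
  refine List.ext_getElem (by simp [permWord, wordRev]) fun i h₁ h₂ => ?_
  have hi : i < 9 := by simpa [permWord] using h₁
  simp [permWord, wordRev, Fin.rev]

theorem rauzyB_eq_inv {n : ℕ} (π : Equiv.Perm (Fin n)) : rauzyB π = (rauzyA π⁻¹)⁻¹ := by
  unfold rauzyA rauzyB
  split <;> simp

theorem hyperellipticCodes_check :
    (codeMem (encodeWord [8, 7, 6, 5, 4, 3, 2, 1, 0]) hyperellipticCodes &&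
      !codeMem (encodeWord [8, 7, 1, 0, 4, 3, 2, 6, 5]) hyperellipticCodes &&
      hyperellipticCodes.all fun c =>
        codeMem (encodeWord (wordA (decodeWord 9 c))) hyperellipticCodes &&
          codeMem (encodeWord (wordInv (decodeWord 9 c))) hyperellipticCodes &&
          codeMem (encodeWord (wordRev (decodeWord 9 c))) hyperellipticCodes) = true := by
  decide +kernel

theorem hyperellipticCodes_spec :
    encodeWord [8, 7, 6, 5, 4, 3, 2, 1, 0] ∈ hyperellipticCodes ∧
      encodeWord [8, 7, 1, 0, 4, 3, 2, 6, 5] ∉ hyperellipticCodes ∧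
      ∀ c ∈ hyperellipticCodes,
        encodeWord (wordA (decodeWord 9 c)) ∈ hyperellipticCodes ∧
          encodeWord (wordInv (decodeWord 9 c)) ∈ hyperellipticCodes ∧
          encodeWord (wordRev (decodeWord 9 c)) ∈ hyperellipticCodes := by
  have h := hyperellipticCodes_check
  simp only [Bool.and_eq_true, Bool.not_eq_true', ← Bool.not_eq_true, List.all_eq_true,
    codeMem_eq_true_iff, and_assoc] at h
  exact h

theorem encodeWord_permWord_mem_of_mem_rauzyClassEx {π σ : Equiv.Perm (Fin 9)}
    (hπ : encodeWord (permWord π) ∈ hyperellipticCodes) (hσ : σ ∈ RauzyClassEx π) :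
    encodeWord (permWord σ) ∈ hyperellipticCodes := by
  have closed (τ : Equiv.Perm (Fin 9)) (hτ : encodeWord (permWord τ) ∈ hyperellipticCodes) :
      encodeWord (permWord (rauzyA τ)) ∈ hyperellipticCodes ∧
        encodeWord (permWord τ⁻¹) ∈ hyperellipticCodes ∧
        encodeWord (permWord (Fin.revPerm * τ * Fin.revPerm)) ∈ hyperellipticCodes := by
    simpa only [decodeWord_encodeWord_permWord, ← permWord_rauzyA, ← permWord_inv,
      ← permWord_revPerm_conj] using hyperellipticCodes_spec.2.2 _ hτ
  refine hσ {τ | encodeWord (permWord τ) ∈ hyperellipticCodes} hπ (fun τ hτ => (closed τ hτ).1)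
    (fun τ hτ => ?_) (fun τ hτ => (closed _ (closed τ hτ).2.1).2.2)
  rw [rauzyB_eq_inv]
  exact (closed _ (closed _ (closed τ hτ).2.1).1).2.1

/-- The permutations of `{1, …, 9}` with bottom lines
`(9,8,7,6,5,4,3,2,1)` and `(4,3,7,6,5,9,8,2,1)` are irreducible and lie in
distinct extended Rauzy classes (hyperelliptic and nonhyperelliptic
components of `H(3,3)`). -/
theorem rauzyClassEx_H33_distinct (π σ : Equiv.Perm (Fin 9))
    (hπ : ∀ i, π⁻¹ i = ![8,7,6,5,4,3,2,1,0] i)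
    (hσ : ∀ i, σ⁻¹ i = ![3,2,6,5,4,8,7,1,0] i) :
    IrreduciblePerm π ∧ IrreduciblePerm σ ∧ σ ∉ RauzyClassEx π := by
  have hu : permWord π⁻¹ = [8, 7, 6, 5, 4, 3, 2, 1, 0] := by
    simp [permWord, hπ, List.ofFn_succ]
  have hw : permWord π = [8, 7, 6, 5, 4, 3, 2, 1, 0] := by
    rw [← inv_inv π, permWord_inv, hu]
    decide
  have hv : permWord σ = [8, 7, 1, 0, 4, 3, 2, 6, 5] := by
    rw [← inv_inv σ, permWord_inv]
    simp only [permWord, hσ, List.ofFn_succ]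
    decide
  have hπ0 : (π 0 : ℕ) = 8 := by
    simpa [permWord] using congrArg (fun w => w.getD 0 0) hw
  have hσ0 : (σ 0 : ℕ) = 8 := by
    simpa [permWord] using congrArg (fun w => w.getD 0 0) hv
  refine ⟨fun k hk h => ?_, fun k hk h => ?_, fun h => ?_⟩
  · have := h 0 (Nat.zero_le k)
    omega
  · have := h 0 (Nat.zero_le k)
    omega
  · refine hyperellipticCodes_spec.2.1 ?_
    rw [← hv]
    exact encodeWord_permWord_mem_of_mem_rauzyClassEx (by rw [hw]; exact hyperellipticCodes_spec.1) h
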